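/- For every integer m ≥ 2 and every integer i with 1 ≤ i ≤ m−1, one has d_i(m+1)/d_i(m) < F(m,i), where F(m,i) = ((m+i+1)(4m+3)(4m+5)) / (2(m+1)(4m^2 − 2i^2 + 9m + 5 − i·√(4m + 4i^2 + 5))). -/

import Mathlib

/-- The Boros-Moll coefficient `d_i(m)`, as a real number:
`d_i(m) = 4^(-m) * sum_{k=0}^m 2^k * C(2m-2k, m-k) * C(m+k, m) * C(k, i)`. -/
noncomputable def d (m i : ℕ) : ℝ :=
  (∑ k ∈ Finset.range (m + 1),
      (2 : ℝ) ^ k * (Nat.choose (2 * m - 2 * k) (m - k) : ℝ) *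
        (Nat.choose (m + k) m : ℝ) * (Nat.choose k i : ℝ)) / 4 ^ m

/-- `F(m,i) = ((m+i+1)(4m+3)(4m+5)) / (2(m+1)(4m^2 - 2i^2 + 9m + 5 - i*sqrt(4m + 4i^2 + 5)))`. -/
noncomputable def F (m i : ℕ) : ℝ :=
  (((m : ℝ) + i + 1) * (4 * m + 3) * (4 * m + 5)) /
    (2 * ((m : ℝ) + 1) *
      (4 * (m : ℝ) ^ 2 - 2 * i ^ 2 + 9 * m + 5 - i * Real.sqrt (4 * m + 4 * i ^ 2 + 5)))

/-- The factor of the summands of `d m i`, `d (m + 1) i` and `d (m + 2) i` used as a common base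
in the telescoping proof of the recurrence in `m`. -/
noncomputable def commonTerm (m i k : ℕ) : ℝ :=
  (2 : ℝ) ^ k * (Nat.centralBinom (m + 2 - k) : ℝ) * (Nat.choose (m + k) m : ℝ) *
    (Nat.choose k i : ℝ)

lemma centralBinom_succ_cast (n : ℕ) :
    ((n : ℝ) + 1) * (Nat.centralBinom (n + 1) : ℝ) =
      2 * (2 * n + 1) * (Nat.centralBinom n : ℝ) := by
  exact_mod_cast Nat.succ_mul_centralBinom_succ n

lemma choose_add_succ_cast (m k : ℕ) :
    ((m : ℝ) + 1) * (Nat.choose (m + 1 + k) (m + 1) : ℝ) =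
      (m + k + 1) * (Nat.choose (m + k) m : ℝ) := by
  have h := Nat.add_one_mul_choose_eq (m + k) m
  rw [show m + k + 1 = m + 1 + k by ring] at h
  have h' : ((m : ℝ) + 1 + k) * (Nat.choose (m + k) m : ℝ) =
      (Nat.choose (m + 1 + k) (m + 1) : ℝ) * (m + 1) := by exact_mod_cast h
  linarith

lemma choose_succ_left_cast (k i : ℕ) :
    ((k : ℝ) + 1 - i) * (Nat.choose (k + 1) i : ℝ) = (k + 1) * (Nat.choose k i : ℝ) := by
  rcases Nat.lt_or_ge k i with h | h
  · rw [Nat.choose_eq_zero_of_lt h]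
    rcases Nat.lt_or_ge (k + 1) i with h' | h'
    · rw [Nat.choose_eq_zero_of_lt h']; simp
    · obtain rfl : i = k + 1 := by omega
      push_cast; ring
  · have h1 := Nat.choose_mul_succ_eq k i
    have h2 : ((k + 1 - i : ℕ) : ℝ) = (k : ℝ) + 1 - i := by
      rw [Nat.cast_sub (by omega)]; push_cast; ring
    have h3 : (Nat.choose k i : ℝ) * (k + 1) =
        (Nat.choose (k + 1) i : ℝ) * ((k + 1 - i : ℕ) : ℝ) := by exact_mod_cast h1
    rw [h2] at h3
    linarith

lemma choose_add_succ_right_cast (m k : ℕ) :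
    ((k : ℝ) + 1) * (Nat.choose (m + (k + 1)) m : ℝ) =
      (m + k + 1) * (Nat.choose (m + k) m : ℝ) := by
  have h := choose_succ_left_cast (m + k) m
  push_cast at h
  rw [← add_assoc m k 1]
  linarith

lemma two_mul_sub_add_one_ne_zero (m k : ℕ) : 2 * ((m : ℝ) - k) + 1 ≠ 0 := by
  have h : (2 * ((m : ℤ) - k) + 1) ≠ 0 := by omega
  exact_mod_cast h

lemma two_mul_sub_add_three_ne_zero (m k : ℕ) : 2 * ((m : ℝ) - k) + 3 ≠ 0 := by
  have h : (2 * ((m : ℤ) - k) + 3) ≠ 0 := by omega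
  exact_mod_cast h

lemma d_eq_sum_centralBinom (m i : ℕ) :
    4 ^ m * d m i = ∑ k ∈ Finset.range (m + 1),
      (2 : ℝ) ^ k * (Nat.centralBinom (m - k) : ℝ) * (Nat.choose (m + k) m : ℝ) *
        (Nat.choose k i : ℝ) := by
  rw [d, mul_div_cancel₀ _ (by positivity)]
  refine Finset.sum_congr rfl fun k _ => ?_
  rw [Nat.centralBinom, Nat.mul_sub]

lemma d_eq_sum_commonTerm (m i : ℕ) :
    4 ^ m * d m i = ∑ k ∈ Finset.range (m + 3),
      commonTerm m i k * (((m : ℝ) - k + 1) * (m - k + 2) /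
        (4 * (2 * (m - k) + 1) * (2 * (m - k) + 3))) := by
  rw [d_eq_sum_centralBinom, Finset.sum_range_succ _ (m + 2), Finset.sum_range_succ _ (m + 1)]
  rw [Finset.sum_congr rfl (g := fun k => commonTerm m i k * (((m : ℝ) - k + 1) * (m - k + 2) /
        (4 * (2 * (m - k) + 1) * (2 * (m - k) + 3))))]
  · push_cast; ring
  · intro k hk
    obtain ⟨j, rfl⟩ := Nat.exists_eq_add_of_le (Nat.lt_succ_iff.mp (Finset.mem_range.mp hk))
    have h1 := centralBinom_succ_cast j
    have h2 := centralBinom_succ_cast (j + 1)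
    have e1 : k + j - k = j := by omega
    have e2 : k + j + 2 - k = j + 1 + 1 := by omega
    rw [commonTerm, e1, e2]
    push_cast at h2 ⊢
    have h3 : (Nat.centralBinom j : ℝ) = Nat.centralBinom (j + 1 + 1) *
        (((k : ℝ) + j - k + 1) * (k + j - k + 2) /
        (4 * (2 * (k + j - k) + 1) * (2 * (k + j - k) + 3))) := by
      rw [add_sub_cancel_left, ← mul_div_assoc, eq_div_iff (by positivity)]
      linear_combination (-(2 * (2 * (j : ℝ) + 3))) * h1 - ((j : ℝ) + 1) * h2
    rw [h3]; ring

lemma d_succ_eq_sum_commonTerm (m i : ℕ) :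
    4 ^ (m + 1) * d (m + 1) i = ∑ k ∈ Finset.range (m + 3),
      commonTerm m i k * (((m : ℝ) - k + 2) * (m + k + 1) /
        (2 * (2 * (m - k) + 3) * (m + 1))) := by
  rw [d_eq_sum_centralBinom, Finset.sum_range_succ _ (m + 2)]
  rw [Finset.sum_congr rfl (g := fun k => commonTerm m i k * (((m : ℝ) - k + 2) * (m + k + 1) /
        (2 * (2 * (m - k) + 3) * (m + 1))))]
  · push_cast; ring
  · intro k hk
    have hk' : k ≤ m + 1 := Nat.lt_succ_iff.mp (Finset.mem_range.mp hk)
    obtain ⟨j, hj⟩ := Nat.exists_eq_add_of_le hk'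
    have h1 := centralBinom_succ_cast j
    have h2 := choose_add_succ_cast m k
    have e1 : m + 1 - k = j := by omega
    have e2 : m + 2 - k = j + 1 := by omega
    have hm : (m : ℝ) = k + j - 1 := by
      have : (m : ℝ) + 1 = k + j := by exact_mod_cast hj
      linarith
    rw [commonTerm, e1, e2]
    have h3 : (Nat.centralBinom j : ℝ) = Nat.centralBinom (j + 1) *
        (((m : ℝ) - k + 2) / (2 * (2 * (m - k) + 3))) := by
      have e3 : 2 * (2 * ((m : ℝ) - k) + 3) = 2 * (2 * j + 1) := by rw [hm]; ring
      rw [e3, ← mul_div_assoc, eq_div_iff (by positivity), hm]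
      linear_combination -h1
    have h4 : (Nat.choose (m + 1 + k) (m + 1) : ℝ) =
        (m + k + 1) / (m + 1) * (Nat.choose (m + k) m : ℝ) := by
      rw [div_mul_eq_mul_div, eq_div_iff (by positivity)]
      linear_combination h2
    rw [h3, h4]
    have := two_mul_sub_add_three_ne_zero m k
    field_simp

lemma d_succ_succ_eq_sum_commonTerm (m i : ℕ) :
    4 ^ (m + 2) * d (m + 2) i = ∑ k ∈ Finset.range (m + 3),
      commonTerm m i k * (((m : ℝ) + k + 1) * (m + k + 2) / ((m + 1) * (m + 2))) := by
  rw [d_eq_sum_centralBinom]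
  refine Finset.sum_congr rfl fun k _ => ?_
  have h1 := choose_add_succ_cast m k
  have h2 := choose_add_succ_cast (m + 1) k
  have h3 : (Nat.choose (m + 2 + k) (m + 2) : ℝ) = Nat.choose (m + k) m *
      (((m : ℝ) + k + 1) * (m + k + 2) / ((m + 1) * (m + 2))) := by
    rw [← mul_div_assoc, eq_div_iff (by positivity)]
    push_cast at h2
    rw [show m + 2 + k = m + 1 + 1 + k by ring]
    linear_combination ((m : ℝ) + 1) * h2 + ((m : ℝ) + k + 2) * h1
  rw [commonTerm, h3]; ring

lemma commonTerm_succ (m i k : ℕ) (hk : k ≤ m + 1) :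
    (2 * ((m : ℝ) - k) + 3) * ((k : ℝ) + 1 - i) * commonTerm m i (k + 1) =
      (m - k + 2) * (m + k + 1) * commonTerm m i k := by
  obtain ⟨j, hj⟩ := Nat.exists_eq_add_of_le hk
  have e1 : m + 2 - (k + 1) = j := by omega
  have e2 : m + 2 - k = j + 1 := by omega
  have hm : (m : ℝ) - k = j - 1 := by
    have : (m : ℝ) + 1 = k + j := by exact_mod_cast hj
    linarith
  have h1 := centralBinom_succ_cast j
  have h2 := choose_succ_left_cast k i
  have h3 := choose_add_succ_right_cast m k
  have hk0 : (k : ℝ) + 1 ≠ 0 := by positivity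
  rw [commonTerm, commonTerm, e1, e2, hm, pow_succ]
  apply mul_left_cancel₀ hk0
  calc _ = (2 : ℝ) ^ k * (2 * (2 * j + 1) * (Nat.centralBinom j : ℝ)) *
        (((k : ℝ) + 1) * (Nat.choose (m + (k + 1)) m : ℝ)) *
        (((k : ℝ) + 1 - i) * (Nat.choose (k + 1) i : ℝ)) := by ring
    _ = _ := by rw [← h1, h2, h3]; ring

/-- The polynomial part of the telescoping certificate. -/
noncomputable def certPoly (m i k : ℝ) : ℝ :=
  (m + 2 - i) * k ^ 2 - ((2 * m + 1) * (2 * m + 3) / 2 + (m + 2 - i)) * k +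
    (m + 1) * (m + 2) * (m + 1 + i)

/-- The coefficient of `commonTerm m i k` in the summand of the recurrence. -/
noncomputable def recCoeff (m i k : ℝ) : ℝ :=
  (m + i + 1) * (4 * m + 3) * (4 * m + 5) *
      ((m - k + 1) * (m - k + 2) / (4 * (2 * (m - k) + 1) * (2 * (m - k) + 3))) -
    (-4 * i ^ 2 + 8 * m ^ 2 + 24 * m + 19) * (m + 1) / 2 *
      ((m - k + 2) * (m + k + 1) / (2 * (2 * (m - k) + 3) * (m + 1))) +
    (m + 2 - i) * (m + 1) * (m + 2) / 4 * ((m + k + 1) * (m + k + 2) / ((m + 1) * (m + 2)))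

lemma recCoeff_eq (m i k : ℝ) (h1 : 2 * (m - k) + 1 ≠ 0) (h3 : 2 * (m - k) + 3 ≠ 0)
    (hm1 : m + 1 ≠ 0) (hm2 : m + 2 ≠ 0) :
    recCoeff m i k = certPoly m i (k + 1) / (2 * (m - k) + 1) *
      ((m - k + 2) * (m + k + 1) / (2 * (m - k) + 3)) -
      (k - i) * certPoly m i k / (2 * (m - k) + 3) := by
  obtain ⟨j, rfl⟩ : ∃ j, m = k + j := ⟨m - k, by ring⟩
  unfold recCoeff certPoly
  simp only [add_sub_cancel_left] at h1 h3 ⊢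
  rw [mul_comm] at h1 h3
  field_simp
  ring

lemma sum_range_recCoeff (m i : ℕ) (hi : 1 ≤ i) (K : ℕ) (hK : K ≤ m + 2) :
    ∑ k ∈ Finset.range K, commonTerm m i k * recCoeff m i k =
      ((K : ℝ) - i) * certPoly m i K / (2 * (m - K) + 3) * commonTerm m i K := by
  induction K with
  | zero => simp [commonTerm, Nat.choose_eq_zero_of_lt hi]
  | succ K ih =>
    rw [Finset.sum_range_succ, ih (by omega)]
    have h1 := two_mul_sub_add_one_ne_zero m K
    have h3 := two_mul_sub_add_three_ne_zero m K
    rw [recCoeff_eq _ _ _ h1 h3 (by positivity) (by positivity)]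
    have hs := commonTerm_succ m i K (by omega)
    have e : 2 * ((m : ℝ) - (K + 1 : ℕ)) + 3 = 2 * (m - K) + 1 := by push_cast; ring
    have hs' : ((K : ℝ) + 1 - i) * commonTerm m i (K + 1) =
        (m - K + 2) * (m + K + 1) / (2 * (m - K) + 3) * commonTerm m i K := by
      rw [div_mul_eq_mul_div, eq_div_iff h3]
      linear_combination hs
    rw [e]
    push_cast
    linear_combination -(certPoly m i (K + 1) / (2 * ((m : ℝ) - K) + 1)) * hs'

lemma sum_recCoeff_eq_zero (m i : ℕ) (hi : 1 ≤ i) :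
    ∑ k ∈ Finset.range (m + 3), commonTerm m i k * recCoeff m i k = 0 := by
  have h1 := two_mul_sub_add_one_ne_zero m (m + 2)
  have h3 := two_mul_sub_add_three_ne_zero m (m + 2)
  rw [Finset.sum_range_succ, sum_range_recCoeff m i hi (m + 2) le_rfl,
    recCoeff_eq _ _ _ h1 h3 (by positivity) (by positivity)]
  push_cast
  ring

/-- The second-order recurrence in `m` for the Boros-Moll coefficients. -/
lemma d_recurrence (m i : ℕ) (hi : 1 ≤ i) :
    4 * ((m : ℝ) + 2 - i) * (m + 1) * (m + 2) * d (m + 2) i =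
      2 * (m + 1) * (-4 * i ^ 2 + 8 * m ^ 2 + 24 * m + 19) * d (m + 1) i -
        (m + i + 1) * (4 * m + 3) * (4 * m + 5) * d m i := by
  have h := sum_recCoeff_eq_zero m i hi
  have key : ((m : ℝ) + i + 1) * (4 * m + 3) * (4 * m + 5) * (4 ^ m * d m i) -
      (-4 * (i : ℝ) ^ 2 + 8 * m ^ 2 + 24 * m + 19) * (m + 1) / 2 *
        (4 ^ (m + 1) * d (m + 1) i) +
      ((m : ℝ) + 2 - i) * (m + 1) * (m + 2) / 4 * (4 ^ (m + 2) * d (m + 2) i) = 0 := by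
    rw [d_eq_sum_commonTerm, d_succ_eq_sum_commonTerm, d_succ_succ_eq_sum_commonTerm, ← h,
      Finset.mul_sum, Finset.mul_sum, Finset.mul_sum, ← Finset.sum_sub_distrib,
      ← Finset.sum_add_distrib]
    refine Finset.sum_congr rfl fun k _ => ?_
    unfold recCoeff
    ring
  have h4 : (4 : ℝ) ^ m ≠ 0 := by positivity
  apply mul_left_cancel₀ h4
  rw [pow_succ, pow_succ] at key
  linear_combination key

lemma d_pos {m i : ℕ} (h : i ≤ m) : 0 < d m i := by
  refine div_pos (Finset.sum_pos' (fun k _ => by positivity) ⟨m, by simp, ?_⟩) (by positivity)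
  have h1 : 0 < Nat.choose m i := Nat.choose_pos h
  have h2 : 0 < Nat.choose (m + m) m := Nat.choose_pos (by omega)
  simp only [Nat.sub_self, Nat.choose_self]
  positivity

lemma d_eq_zero {m i : ℕ} (h : m < i) : d m i = 0 := by
  rw [d, Finset.sum_eq_zero, zero_div]
  intro k hk
  have hk' : k < i := lt_of_le_of_lt (Nat.lt_succ_iff.mp (Finset.mem_range.mp hk)) h
  simp [Nat.choose_eq_zero_of_lt hk']

lemma F_denom_pos (x y : ℝ) (hy : 0 ≤ y) (hyx : y ≤ x) :
    0 < 4 * x ^ 2 - 2 * y ^ 2 + 9 * x + 5 - y * √(4 * x + 4 * y ^ 2 + 5) := by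
  have hs : √(4 * x + 4 * y ^ 2 + 5) ≤ 2 * x + 3 := by
    rw [Real.sqrt_le_iff]
    constructor <;> nlinarith
  nlinarith [mul_le_mul_of_nonneg_left hs hy]

lemma F_step_sqrt_ineq (n y s t : ℝ) (hy : 1 ≤ y) (hyn : y ≤ n) (hs : 0 ≤ s) (ht : 0 ≤ t)
    (hs2 : s ^ 2 = 4 * n + 4 * y ^ 2 + 1) (ht2 : t ^ 2 = 4 * n + 4 * y ^ 2 + 5) :
    s * (4 * n ^ 2 + 9 * n + 5 - 2 * y ^ 2) - t * (4 * n ^ 2 + 7 * n + 3 - 2 * y ^ 2) ≤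
      y * (1 + s * t - 4 * y ^ 2) := by
  have hT : 0 < 4 * n + 4 * y ^ 2 + 3 := by nlinarith
  have hst : 0 ≤ s * t := by positivity
  have hw2 : (s * t) ^ 2 = (4 * n + 4 * y ^ 2 + 3) ^ 2 - 4 := by
    rw [mul_pow, hs2, ht2]; ring
  have hw_le : s * t ≤ 4 * n + 4 * y ^ 2 + 3 := by nlinarith
  have hw_ge : y * (4 * n + 4 * y ^ 2 + 3) - 1 ≤ y * (s * t) := by
    refine (le_abs_self _).trans (abs_le_of_sq_le_sq ?_ (mul_nonneg (by linarith) hst))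
    rw [mul_pow, hw2]
    nlinarith [mul_nonneg (by linarith : (0 : ℝ) ≤ y) hT.le, mul_pos hT (by linarith : 0 < y),
      mul_le_mul_of_nonneg_right hy hT.le]
  have hw_ge' : 4 * n + 4 * y ^ 2 + 2 ≤ s * t := by
    by_contra! hlt
    nlinarith
  have hv : 4 * y + 2 ≤ s + t := by
    refine (le_abs_self _).trans (abs_le_of_sq_le_sq ?_ (by positivity))
    nlinarith
  have hv_pos : 0 < s + t := by linarith
  have hR : (4 * n * y + 4 * y - 1) * (4 * y + 2) ≤
      (y * (1 + s * t - 4 * y ^ 2)) * (s + t) := by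
    apply mul_le_mul _ hv (by positivity)
    · nlinarith
    · nlinarith
  have hL : (s * (4 * n ^ 2 + 9 * n + 5 - 2 * y ^ 2) -
      t * (4 * n ^ 2 + 7 * n + 3 - 2 * y ^ 2)) * (s + t) =
      (2 * n + 2) * (4 * n + 4 * y ^ 2 + 1 + s * t) -
        4 * (4 * n ^ 2 + 7 * n + 3 - 2 * y ^ 2) := by
    linear_combination (4 * n ^ 2 + 9 * n + 5 - 2 * y ^ 2) * hs2 -
      (4 * n ^ 2 + 7 * n + 3 - 2 * y ^ 2) * ht2
  refine le_of_mul_le_mul_right ?_ hv_pos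
  rw [hL]
  refine le_trans ?_ hR
  nlinarith [mul_le_mul_of_nonneg_left hw_le (by linarith : 0 ≤ 2 * n + 2),
    mul_nonneg (by linarith : 0 ≤ y) (by linarith : 0 ≤ n - y)]

lemma F_step_ineq (x y : ℝ) (hy : 1 ≤ y) (hyx : y ≤ x) :
    (4 * x ^ 2 - 2 * y ^ 2 + 15 * x + 14 + y * √(4 * x + 4 * y ^ 2 + 5)) *
      (4 * (x + 1) ^ 2 - 2 * y ^ 2 + 9 * (x + 1) + 5 - y * √(4 * (x + 1) + 4 * y ^ 2 + 5)) ≤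
      (x + 2 - y) * (x + 2 + y) * (4 * x + 7) * (4 * x + 9) := by
  have h0 : (0 : ℝ) ≤ 4 * x + 4 * y ^ 2 + 5 := by nlinarith
  have h1 : (0 : ℝ) ≤ 4 * (x + 1) + 4 * y ^ 2 + 5 := by nlinarith
  have h := F_step_sqrt_ineq (x + 1) y _ _ hy (by linarith) (Real.sqrt_nonneg _)
    (Real.sqrt_nonneg _) ((Real.sq_sqrt h0).trans (by ring)) (Real.sq_sqrt h1)
  have h' := mul_le_mul_of_nonneg_left h (by linarith : 0 ≤ y)
  linarith

lemma d_succ_lt_iff_F_form {m i : ℕ} (h : i ≤ m) :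
    d (m + 1) i / d m i < F m i ↔
      2 * ((m : ℝ) + 1) *
        (4 * (m : ℝ) ^ 2 - 2 * i ^ 2 + 9 * m + 5 - i * √(4 * m + 4 * i ^ 2 + 5)) *
        d (m + 1) i < ((m : ℝ) + i + 1) * (4 * m + 3) * (4 * m + 5) * d m i := by
  have hQ := F_denom_pos m i (by positivity) (by exact_mod_cast h)
  rw [F, div_lt_div_iff₀ (d_pos h) (by positivity), mul_comm (d (m + 1) i)]

lemma d_succ_self_ratio_lt_F (i : ℕ) (hi : 1 ≤ i) : d (i + 1) i / d i i < F i i := by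
  rw [d_succ_lt_iff_F_form le_rfl]
  obtain ⟨n, rfl⟩ := Nat.exists_eq_add_of_le' hi
  have hrec := d_recurrence n (n + 1) hi
  rw [d_eq_zero (Nat.lt_succ_self n)] at hrec
  have hpos := d_pos (le_refl (n + 1))
  set y : ℝ := ((n + 1 : ℕ) : ℝ) with hy
  have hn : (n : ℝ) = y - 1 := by rw [hy]; push_cast; ring
  rw [hn] at hrec
  have hy1 : 1 ≤ y := by rw [hy]; exact_mod_cast hi
  have hr : 2 * (y + 1) * d (n + 1 + 1) (n + 1) =
      (2 * y + 1) * (2 * y + 3) * d (n + 1) (n + 1) := by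
    apply mul_left_cancel₀ (by positivity : 2 * y ≠ 0)
    linear_combination hrec
  have hs0 := Real.sqrt_nonneg (4 * y + 4 * y ^ 2 + 5)
  have hs2 := Real.sq_sqrt (by positivity : (0 : ℝ) ≤ 4 * y + 4 * y ^ 2 + 5)
  set s := √(4 * y + 4 * y ^ 2 + 5)
  have hs : (2 * y + 1) * (2 * y + 3) + 2 < (2 * y + 3) * s := by
    refine (le_abs_self _).trans_lt (abs_lt_of_sq_lt_sq ?_ (by positivity))
    rw [mul_pow, hs2]
    nlinarith
  have hq : (2 * y + 3) * (4 * y ^ 2 - 2 * y ^ 2 + 9 * y + 5 - y * s) <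
      (4 * y + 3) * (4 * y + 5) := by
    nlinarith [mul_lt_mul_of_pos_left hs (by linarith : 0 < y)]
  have hm := mul_lt_mul_of_pos_left hq
    (mul_pos (by linarith : 0 < 2 * y + 1) hpos)
  linear_combination hm + (4 * y ^ 2 - 2 * y ^ 2 + 9 * y + 5 - y * s) * hr

lemma ratio_lt_F_succ {m i : ℕ} (hi : 1 ≤ i) (him : i ≤ m)
    (h : d (m + 1) i / d m i < F m i) : d (m + 2) i / d (m + 1) i < F (m + 1) i := by
  rw [d_succ_lt_iff_F_form him] at h
  rw [d_succ_lt_iff_F_form (by omega)]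
  have hrec := d_recurrence m i hi
  have hpos : 0 < d (m + 1) i := d_pos (by omega)
  have hy : (1 : ℝ) ≤ i := by exact_mod_cast hi
  have hyx : (i : ℝ) ≤ m := by exact_mod_cast him
  have hQ := F_denom_pos ((m : ℝ) + 1) i (by linarith) (by linarith)
  have hstep := F_step_ineq m i hy hyx
  push_cast
  set x : ℝ := (m : ℝ)
  set y : ℝ := (i : ℝ)
  set s := √(4 * x + 4 * y ^ 2 + 5)
  set Q := 4 * (x + 1) ^ 2 - 2 * y ^ 2 + 9 * (x + 1) + 5 - y * √(4 * (x + 1) + 4 * y ^ 2 + 5)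
  have hlt : 2 * (x + 2 - y) * (x + 2) * d (m + 2) i <
      (4 * x ^ 2 - 2 * y ^ 2 + 15 * x + 14 + y * s) * d (m + 1) i := by
    refine lt_of_mul_lt_mul_left ?_ (by linarith : 0 ≤ 2 * (x + 1))
    linear_combination h + hrec
  have h1 := mul_lt_mul_of_pos_left hlt hQ
  have h2 := mul_le_mul_of_nonneg_right hstep hpos.le
  refine lt_of_mul_lt_mul_left ?_ (by linarith : 0 ≤ x + 2 - y)
  change (x + 2 - y) * (2 * (x + 1 + 1) * Q * d (m + 2) i) < _
  linear_combination h1 + h2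

theorem boros_moll_ratio_lt_F (m i : ℕ) (hm : 2 ≤ m) (hi : 1 ≤ i) (hi' : i ≤ m - 1) :
    d (m + 1) i / d m i < F m i := by
  have him : i ≤ m := by omega
  clear hm hi'
  induction m, him using Nat.le_induction with
  | base => exact d_succ_self_ratio_lt_F i hi
  | succ n hn ih => exact ratio_lt_F_succ hi hn ih
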